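/- Let A > 0 and define w(t,x) = −t G_A(x/t) for t > 0 and x ∈ ℝ. Then for every q ∈ [0,R] with H(q) < A and every t > 0, at the point (t, t H'(q)) the function w admits the partial derivatives ∂_t w(t, t H'(q)) = −H(q) and ∂_x w(t, t H'(q)) = q; in particular ∂_t w + H(∂_x w) = 0 at the point (t, t H'(q)). -/

import Mathlib

open Set

noncomputable section

/-- `G_A(p) = sup_{y ∈ [0,R]} (−p y + min{H(y), A})`. -/
def GA (H : ℝ → ℝ) (R A p : ℝ) : ℝ := sSup ((fun y => -(p * y) + min (H y) A) '' Icc 0 R)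

/-- `w(t,x) = −t G_A(x/t)` (for `t > 0`). -/
def wGA (H : ℝ → ℝ) (R A t x : ℝ) : ℝ := -t * GA H R A (x / t)

/-- A strictly concave function lies strictly below its tangent lines. -/
theorem StrictConcaveOn.lt_tangent {S : Set ℝ} {f : ℝ → ℝ} {f' x y : ℝ}
    (hf : StrictConcaveOn ℝ S f) (hx : x ∈ S) (hy : y ∈ S) (hxy : y ≠ x)
    (hd : HasDerivAt f f' x) : f y < f x + f' * (y - x) := by
  rcases lt_or_gt_of_ne hxy with h | h
  · have := hf.lt_slope_of_hasDerivAt hy hx h hd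
    rw [slope_def_field, lt_div_iff₀ (by linarith)] at this
    linarith
  · have := hf.slope_lt_of_hasDerivAt hx hy h hd
    rw [slope_def_field, div_lt_iff₀ (by linarith)] at this
    linarith

/-- Danskin's theorem in one dimension: if `y ↦ -(p₀ * y) + f y` has the unique maximizer `q` on
the compact set `K`, then the Legendre-type transform of `f` on `K` has derivative `-q` at `p₀`. -/
theorem hasDerivAt_sSup_image_of_unique_max {K : Set ℝ} (hK : IsCompact K) {f : ℝ → ℝ}
    (hf : ContinuousOn f K) {p₀ q : ℝ} (hq : q ∈ K)
    (hmax : ∀ y ∈ K, y ≠ q → -(p₀ * y) + f y < -(p₀ * q) + f q) :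
    HasDerivAt (fun p => sSup ((fun y => -(p * y) + f y) '' K)) (-q) p₀ := by
  have hcont (p : ℝ) : ContinuousOn (fun y => -(p * y) + f y) K := by fun_prop
  have hlower (p : ℝ) : -(p * q) + f q ≤ sSup ((fun y => -(p * y) + f y) '' K) :=
    le_csSup (hK.image_of_continuousOn (hcont p)).bddAbove (mem_image_of_mem _ hq)
  have hbase : sSup ((fun y => -(p₀ * y) + f y) '' K) = -(p₀ * q) + f q := by
    refine le_antisymm (csSup_le ⟨_, mem_image_of_mem _ hq⟩ ?_) (hlower p₀)
    rintro _ ⟨y, hy, rfl⟩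
    rcases eq_or_ne y q with rfl | h
    · exact le_rfl
    · exact (hmax y hy h).le
  obtain ⟨C, hC⟩ := hK.isBounded.exists_norm_le
  have hC0 : 0 ≤ C := (norm_nonneg q).trans (hC q hq)
  rw [hasDerivAt_iff_isLittleO, Asymptotics.isLittleO_iff]
  intro ε hε
  obtain ⟨δ, hδ, hgap⟩ : ∃ δ > 0, ∀ y ∈ K, ε ≤ |y - q| →
      -(p₀ * y) + f y + δ ≤ -(p₀ * q) + f q := by
    have hfar : IsCompact (K ∩ {y | ε ≤ |y - q|}) :=
      hK.inter_right (isClosed_le continuous_const (by fun_prop))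
    rcases (K ∩ {y | ε ≤ |y - q|}).eq_empty_or_nonempty with he | hne
    · refine ⟨1, one_pos, fun y hy hyq => ?_⟩
      exact absurd (show y ∈ K ∩ {y | ε ≤ |y - q|} from ⟨hy, hyq⟩) (he ▸ notMem_empty y)
    · obtain ⟨z, hz, hzmax⟩ := hfar.exists_isMaxOn hne ((hcont p₀).mono inter_subset_left)
      have hzq : z ≠ q := by
        rintro rfl
        have := hz.2
        simp only [mem_ofPred_eq, sub_self, abs_zero] at this
        linarith
      refine ⟨_, sub_pos.2 (hmax z hz.1 hzq), fun y hy hyq => ?_⟩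
      have : -(p₀ * y) + f y ≤ -(p₀ * z) + f z := hzmax ⟨hy, hyq⟩
      linarith
  filter_upwards [Metric.ball_mem_nhds p₀ (show 0 < δ / (2 * C + 1) by positivity)] with p hp
  rw [Metric.mem_ball, Real.dist_eq, lt_div_iff₀ (by positivity)] at hp
  have hupper : sSup ((fun y => -(p * y) + f y) '' K) ≤
      -(p₀ * q) + f q - (p - p₀) * q + ε * |p - p₀| := by
    refine csSup_le ⟨_, mem_image_of_mem _ hq⟩ ?_
    rintro _ ⟨y, hy, rfl⟩
    have habs : -((p - p₀) * (y - q)) ≤ |p - p₀| * |y - q| := by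
      rw [← abs_mul]
      exact neg_le_abs _
    have hp0 := abs_nonneg (p - p₀)
    rcases le_total ε |y - q| with h | h
    · have hyq : |y - q| ≤ 2 * C + 1 := by
        have h1 := abs_le.1 (hC y hy)
        have h2 := abs_le.1 (hC q hq)
        exact abs_le.2 ⟨by linarith [h1.1, h2.2], by linarith [h1.2, h2.1]⟩
      have := mul_le_mul_of_nonneg_left hyq hp0
      have := hgap y hy h
      have := mul_nonneg hε.le hp0
      linarith
    · have := mul_le_mul_of_nonneg_left h hp0
      have : -(p₀ * y) + f y ≤ -(p₀ * q) + f q := by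
        rcases eq_or_ne y q with rfl | hne
        · exact le_rfl
        · exact (hmax y hy hne).le
      linarith
  have := hlower p
  rw [hbase, Real.norm_eq_abs, Real.norm_eq_abs, smul_eq_mul, abs_of_nonneg (by linarith)]
  linarith

/-- for `q ∈ [0,R]` with `H(q) < A` and `t > 0`, at the point
`(t, t H'(q))` the function `w(t,x) = −t G_A(x/t)` has partial derivatives
`∂_t w = −H(q)` and `∂_x w = q`; in particular `∂_t w + H(∂_x w) = 0` there. -/
theorem w_partial_derivatives
    (R : ℝ) (hR : 0 < R) (H : ℝ → ℝ) (hH : ContDiff ℝ 1 H)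
    (hconc : StrictConcaveOn ℝ (Icc 0 R) H)
    (A : ℝ) (hA0 : 0 < A) :
    ∀ q ∈ Icc (0 : ℝ) R, H q < A → ∀ t : ℝ, 0 < t →
      HasDerivAt (fun s => wGA H R A s (t * deriv H q)) (-(H q)) t ∧
      HasDerivAt (fun x => wGA H R A t x) q (t * deriv H q) ∧
      -(H q) + H q = 0 := by
  intro q hq hqA t ht
  have hd : HasDerivAt H (deriv H q) q :=
    (hH.differentiable one_ne_zero q).hasDerivAt
  have hmin : min (H q) A = H q := min_eq_left hqA.le
  have hmax : ∀ y ∈ Icc 0 R, y ≠ q →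
      -(deriv H q * y) + min (H y) A < -(deriv H q * q) + min (H q) A := by
    intro y hy hyq
    have := hconc.lt_tangent hq hy hyq hd
    have := min_le_left (H y) A
    rw [hmin]
    linarith
  have hG : HasDerivAt (GA H R A) (-q) (deriv H q) :=
    hasDerivAt_sSup_image_of_unique_max isCompact_Icc
      (hH.continuous.min continuous_const).continuousOn hq hmax
  have hGval : GA H R A (deriv H q) = -(deriv H q * q) + H q := by
    refine IsGreatest.csSup_eq ⟨⟨q, hq, by simp only [hmin]⟩, ?_⟩
    rintro _ ⟨y, hy, rfl⟩
    rcases eq_or_ne y q with rfl | h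
    · simp only [hmin, le_refl]
    · exact hmin ▸ (hmax y hy h).le
  have hpt : t * deriv H q / t = deriv H q := mul_div_cancel_left₀ _ ht.ne'
  rw [← hpt] at hG
  refine ⟨?_, ?_, neg_add_cancel _⟩
  · have hquot : HasDerivAt (fun s => t * deriv H q / s) (-(t * deriv H q) / t ^ 2) t := by
      simpa using (hasDerivAt_const t (t * deriv H q)).fun_div (hasDerivAt_id t) ht.ne'
    refine ((hasDerivAt_id t).fun_neg.fun_mul (hG.comp t hquot)).congr_deriv ?_
    simp only [Function.comp_apply, id_eq, hpt, hGval]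
    field_simp
    ring
  · have hdiv : HasDerivAt (fun x => x / t) (1 / t) (t * deriv H q) :=
      (hasDerivAt_id _).div_const t
    refine ((hG.comp (t * deriv H q) hdiv).const_mul (-t)).congr_deriv ?_
    field_simp
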